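/- Let J be a reduced Albert algebra over a field F of characteristic not 2 or 3, and let e = (α, j; j', β) be a nonzero element of B(J,F×F). Then e is singular if and only if all of the following hold: (1) T(j,j') = 3αβ; (2) (j')^# = α·j; (3) j^# = β·j'; (4) ⟨j,j'⟩ = 0. Moreover, if α ≠ 0 or β ≠ 0, then conditions (1)–(3) imply condition (4). -/

import Mathlib

set_option synthInstance.maxHeartbeats 1000000
set_option maxHeartbeats 1000000

noncomputable section

open scoped TensorProduct

universe u v

structure OctonionAlgebra (F : Type u) [Field F] : Type (max u (v + 1)) where
  C : Type v
  [ringC : NonAssocRing C]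
  [modC : Module F C]
  [sccC : SMulCommClass F C C]
  [istC : IsScalarTower F C C]
  n : QuadraticForm F C
  finrank_eq : Module.finrank F C = 8
  nondeg : ∀ x : C, (∀ y : C, QuadraticMap.polar (⇑n) x y = 0) → x = 0
  n_one : n 1 = 1
  n_mul : ∀ x y : C, n (x * y) = n x * n y

attribute [instance] OctonionAlgebra.ringC OctonionAlgebra.modC OctonionAlgebra.sccC
  OctonionAlgebra.istC

namespace OctonionAlgebra

variable {F : Type u} [Field F] (O : OctonionAlgebra.{u, v} F)

/-- Conjugation `x̄ := n(x,1)•1 - x` (bundled as a linear map; `polarBilin n x 1 = n(x,1)`). -/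
def conj : O.C →ₗ[F] O.C :=
  (LinearMap.toSpanSingleton F O.C (1 : O.C)).comp ((QuadraticMap.polarBilin O.n).flip 1)
    - LinearMap.id

lemma conj_apply (x : O.C) :
    O.conj x = QuadraticMap.polar (⇑O.n) x 1 • (1 : O.C) - x := rfl

/-- A split octonion algebra: the norm form is isotropic. -/
def IsSplit : Prop := ∃ x : O.C, x ≠ 0 ∧ O.n x = 0

end OctonionAlgebra

/-- A reduced Albert algebra `H₃(C,γ)`. -/
structure ReducedAlbert (F : Type u) [Field F] : Type (max u (v + 1)) where
  O : OctonionAlgebra.{u, v} F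
  γ : Fin 3 → Fˣ

namespace ReducedAlbert

variable {F : Type u} [Field F] (A : ReducedAlbert.{u, v} F)

/-- The ambient space of 3×3 matrices over the octonion algebra. -/
abbrev M : Type v := Matrix (Fin 3) (Fin 3) A.O.C

/-- The 27-dimensional space `H₃(C,γ)` of `γ`-hermitian matrices:
`x = γ⁻¹ ⬝ (x̄)ᵀ ⬝ γ`, i.e. entrywise `x i j = γᵢ⁻¹ γⱼ • conj (x j i)`. -/
def J : Submodule F A.M where
  carrier := {x | ∀ i j, x i j = ((A.γ i : F)⁻¹ * (A.γ j : F)) • A.O.conj (x j i)}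
  add_mem' := by
    intro a b ha hb i j
    show a i j + b i j = ((A.γ i : F)⁻¹ * (A.γ j : F)) • A.O.conj (a j i + b j i)
    rw [map_add, smul_add, ← ha i j, ← hb i j]
  zero_mem' := by
    intro i j
    show (0 : A.O.C) = ((A.γ i : F)⁻¹ * (A.γ j : F)) • A.O.conj (0 : A.O.C)
    rw [map_zero, smul_zero]
  smul_mem' := by
    intro c a ha i j
    show c • a i j = ((A.γ i : F)⁻¹ * (A.γ j : F)) • A.O.conj (c • a j i)
    rw [map_smul, smul_comm, ← ha i j]

/-- The Jordan product `x·y := (xy + yx)/2`. -/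
def jmul (x y : A.M) : A.M := (2 : F)⁻¹ • (x * y + y * x)

/-- The trace `T(x)`: the sum of the diagonal entries, which for hermitian matrices are
scalars `ε•1`; the scalar `ε` is recovered as `n(ε•1, 1)/2`. -/
def trace (x : A.M) : F := (2 : F)⁻¹ * ∑ i, QuadraticMap.polar (⇑A.O.n) (x i i) 1

/-- The trace bilinear form `T(x,y) := T(x·y)`. -/
def tb (x y : A.M) : F := A.trace (A.jmul x y)

/-- The adjoint `x ^ # = x·x − T(x)·x + ½(T(x)² − T(x,x))·1`, the unique quadratic map such
that `T(x^#, y)` is the coefficient of `s` in `N(x + s y)`. -/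
def sharp (x : A.M) : A.M :=
  A.jmul x x - A.trace x • x + ((2 : F)⁻¹ * (A.trace x ^ 2 - A.tb x x)) • (1 : A.M)

/-- The Freudenthal cross product `x × y := (x+y)^# − x^# − y^#`. -/
def cross (x y : A.M) : A.M := A.sharp (x + y) - A.sharp x - A.sharp y

/-- The cubic norm `N`, defined pointwise on `J` by
`N(x)·1 = x·(x·x) − T(x)·(x·x) + ½(T(x)² − T(x,x))·x`; the scalar is recovered by
applying the trace (which takes value `3` on `1`). -/
def norm (x : A.M) : F :=
  (3 : F)⁻¹ * A.trace (A.jmul x (A.jmul x x) - A.trace x • A.jmul x x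
    + ((2 : F)⁻¹ * (A.trace x ^ 2 - A.tb x x)) • x)

/-- The operator `⟨x,y⟩(j) := ½ (y × (x × j) − T(j,y)·x − ⅓·T(x,y)·j)`. -/
def brok (x y j : A.M) : A.M :=
  (2 : F)⁻¹ • (A.cross y (A.cross x j) - A.tb j y • x - ((3 : F)⁻¹ * A.tb x y) • j)

/-- `A` is the split Albert algebra `H₃(Cᵈ, 1)`. -/
def IsSplitAlbert : Prop := A.O.IsSplit ∧ ∀ i, A.γ i = 1

/-- A point of `H₃(C,γ)` with coordinates `(ε₀,ε₁,ε₂; a,b,c)`. -/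
def elt (ε : Fin 3 → F) (a b c : A.O.C) : A.M :=
  Matrix.of
    ![![ε 0 • (1 : A.O.C), c, ((A.γ 0 : F)⁻¹ * (A.γ 2 : F)) • A.O.conj b],
      ![((A.γ 1 : F)⁻¹ * (A.γ 0 : F)) • A.O.conj c, ε 1 • (1 : A.O.C), a],
      ![b, ((A.γ 2 : F)⁻¹ * (A.γ 1 : F)) • A.O.conj a, ε 2 • (1 : A.O.C)]]

/-! ### The Brown algebra `B(J, F×F, ζ)` -/

/-- Ambient space of the Brown algebra `B(J, F×F, ζ)`: elements `(α, j; j', β)`. -/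
abbrev Bam : Type (max u v) := F × A.M × A.M × F

/-- The underlying 56-dimensional space of `B(J, F×F, ζ)`: both middle components lie in `J`. -/
def Bsub : Submodule F A.Bam where
  carrier := {p | p.2.1 ∈ A.J ∧ p.2.2.1 ∈ A.J}
  add_mem' := fun ha hb => ⟨A.J.add_mem ha.1 hb.1, A.J.add_mem ha.2 hb.2⟩
  zero_mem' := ⟨A.J.zero_mem, A.J.zero_mem⟩
  smul_mem' := fun c _ h => ⟨A.J.smul_mem c h.1, A.J.smul_mem c h.2⟩

/-- The product of `B(J, F×F, ζ)`. -/
def bmul (ζ : F) (x y : A.Bam) : A.Bam :=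
  (x.1 * y.1 + ζ * A.tb x.2.1 y.2.2.1,
   x.1 • y.2.1 + y.2.2.2 • x.2.1 + ζ • A.cross x.2.2.1 y.2.2.1,
   y.1 • x.2.2.1 + x.2.2.2 • y.2.2.1 + A.cross x.2.1 y.2.1,
   x.2.2.2 * y.2.2.2 + ζ * A.tb y.2.1 x.2.2.1)

/-- The involution `(α,j;j',β)‾ = (β,j;j',α)` of `B(J, F×F, ζ)`. -/
def binv (x : A.Bam) : A.Bam := (x.2.2.2, x.2.1, x.2.2.1, x.1)

/-- The skew-symmetric element `s₀ = (1,0;0,−1)`. -/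
def s0 : A.Bam := (1, 0, 0, -1)

/-- The triple product `{x,y,z} := (x·ȳ)·z + (z·ȳ)·x − (z·x̄)·y` in `B(J, F×F, ζ)`. -/
def brace (ζ : F) (x y z : A.Bam) : A.Bam :=
  A.bmul ζ (A.bmul ζ x (A.binv y)) z + A.bmul ζ (A.bmul ζ z (A.binv y)) x
    - A.bmul ζ (A.bmul ζ z (A.binv x)) y

/-- The bilinear form of the triple system associated to `B(J, F×F, ζ)` and a skew element
`s`: `b(x,y)` is the unique scalar with `b(x,y)•1 = (x·ȳ − y·x̄)·s`; since the unit of the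
algebra is `(1,0;0,1)`, it is the first component of the right-hand side. -/
def bformS (ζ : F) (s x y : A.Bam) : F :=
  (A.bmul ζ (A.bmul ζ x (A.binv y) - A.bmul ζ y (A.binv x)) s).1

/-- The trilinear product of the triple system associated to `B(J, F×F, ζ)` and `s`:
`t(y,z,w) := 2{y, s·z, w} − b(z,w)·y − b(z,y)·w − b(y,w)·z`. -/
def tformS (ζ : F) (s y z w : A.Bam) : A.Bam :=
  (2 : F) • A.brace ζ y (A.bmul ζ s z) w - A.bformS ζ s z w • y - A.bformS ζ s z y • w
    - A.bformS ζ s y w • z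

/-- The bilinear form of the triple system associated to `B(J, F×F, ζ)` and `s₀`. -/
def bform (ζ : F) (x y : A.Bam) : F := A.bformS ζ A.s0 x y

/-- The trilinear product of the triple system associated to `B(J, F×F, ζ)` and `s₀`. -/
def tform (ζ : F) (y z w : A.Bam) : A.Bam := A.tformS ζ A.s0 y z w

/-- `e` is a singular element of `B(J, F×F, ζ)`: `e ≠ 0` and `U_e(B) ⊆ F·e`
where `U_e(x) := {e,x,e}`. -/
def IsSingular (ζ : F) (e : A.Bam) : Prop :=
  e ≠ 0 ∧ ∀ x ∈ A.Bsub, ∃ c : F, A.brace ζ e x e = c • e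

/-- `I` is an inner ideal of `B(J, F×F, ζ)`: a subspace of `B` with `U_e(B) ⊆ I`
for all `e ∈ I`. -/
def IsInnerIdeal (ζ : F) (I : Submodule F A.Bam) : Prop :=
  I ≤ A.Bsub ∧ ∀ e ∈ I, ∀ x ∈ A.Bsub, A.brace ζ e x e ∈ I

end ReducedAlbert


namespace OctonionAlgebra

variable {F : Type u} [Field F] (O : OctonionAlgebra.{u, v} F)

/-- The polar form of the norm as a bilinear form. -/
abbrev pol : LinearMap.BilinForm F O.C := QuadraticMap.polarBilin O.n

lemma pol_comm (x y : O.C) : O.pol x y = O.pol y x := QuadraticMap.polar_comm _ _ _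

lemma n_add (x y : O.C) : O.n (x + y) = O.n x + O.n y + O.pol x y := by
  simp [QuadraticMap.polar]

lemma pol_self (x : O.C) : O.pol x x = 2 * O.n x := by
  simp [QuadraticMap.polar_self]

lemma n_sub (x y : O.C) : O.n (x - y) = O.n x + O.n y - O.pol x y := by
  rw [sub_eq_add_neg, n_add, (O.pol x).map_neg, QuadraticMap.map_neg]; ring

lemma n_smul (s : F) (x : O.C) : O.n (s • x) = s ^ 2 * O.n x := by
  rw [QuadraticMap.map_smul, smul_eq_mul]; ring

lemma ext_pol {x y : O.C} (h : ∀ z, O.pol x z = O.pol y z) : x = y := by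
  rw [← sub_eq_zero]
  refine O.nondeg _ fun z => ?_
  have := h z
  rw [← sub_eq_zero, ← LinearMap.sub_apply, ← map_sub] at this
  exact this

lemma pol_mul_mul_left (x y z : O.C) : O.pol (x * y) (x * z) = O.n x * O.pol y z := by
  have h := O.n_mul x (y + z)
  rw [mul_add, n_add, n_add, O.n_mul, O.n_mul] at h
  linear_combination h

lemma pol_mul_mul_right (x y z : O.C) : O.pol (y * x) (z * x) = O.n x * O.pol y z := by
  have h := O.n_mul (y + z) x
  rw [add_mul, n_add, n_add, O.n_mul, O.n_mul] at h
  linear_combination h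

lemma pol_mul_mul_add (x y z w : O.C) :
    O.pol (x * y) (z * w) + O.pol (x * w) (z * y) = O.pol x z * O.pol y w := by
  have h := O.pol_mul_mul_left (x + z) y w
  rw [add_mul, add_mul, n_add, map_add, map_add, LinearMap.add_apply, LinearMap.add_apply,
    pol_mul_mul_left, pol_mul_mul_left] at h
  linear_combination h + O.pol_comm (x * w) (z * y)

lemma conj_eq (x : O.C) : O.conj x = O.pol x 1 • (1 : O.C) - x := rfl

lemma pol_mul_left (x y z : O.C) : O.pol (x * y) z = O.pol y (O.conj x * z) := by
  have h := O.pol_mul_mul_add x y 1 z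
  rw [one_mul, one_mul] at h
  rw [conj_eq, sub_mul, smul_mul_assoc, one_mul, map_sub, map_smul, smul_eq_mul]
  linear_combination h - O.pol_comm (x * z) y

lemma pol_mul_right (x y z : O.C) : O.pol (x * y) z = O.pol x (z * O.conj y) := by
  have h := O.pol_mul_mul_add x y z 1
  rw [mul_one, mul_one] at h
  rw [conj_eq, mul_sub, mul_smul_comm, mul_one, map_sub, map_smul, smul_eq_mul]
  linear_combination h

lemma pol_one_one : O.pol 1 1 = 2 := by
  rw [pol_self, O.n_one, mul_one]

lemma conj_one : O.conj 1 = 1 := by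
  rw [conj_eq, pol_one_one, two_smul, add_sub_cancel_right]

lemma pol_conj_one (x : O.C) : O.pol (O.conj x) 1 = O.pol x 1 := by
  rw [conj_eq, map_sub, map_smul, LinearMap.sub_apply, LinearMap.smul_apply, pol_one_one,
    smul_eq_mul]
  ring

lemma conj_conj (x : O.C) : O.conj (O.conj x) = x := by
  rw [conj_eq, pol_conj_one, conj_eq, sub_sub_cancel]

lemma pol_conj_left (x y : O.C) : O.pol (O.conj x) y = O.pol x (O.conj y) := by
  simp only [conj_eq, map_sub, map_smul, LinearMap.sub_apply, LinearMap.smul_apply, smul_eq_mul]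
  rw [O.pol_comm 1 y]
  ring

lemma n_conj (x : O.C) : O.n (O.conj x) = O.n x := by
  rw [conj_eq, n_sub, n_smul, O.n_one, map_smul, LinearMap.smul_apply, O.pol_comm 1 x,
    smul_eq_mul]
  ring

lemma conj_mul (x y : O.C) : O.conj (x * y) = O.conj y * O.conj x := by
  refine O.ext_pol fun z => ?_
  rw [pol_conj_left, pol_mul_left, ← O.pol_mul_right y z, pol_mul_left, pol_comm]

lemma conj_mul_cancel_left (x y : O.C) : O.conj x * (x * y) = O.n x • y := by
  refine O.ext_pol fun z => ?_
  rw [pol_mul_left, conj_conj, pol_mul_mul_left, map_smul, LinearMap.smul_apply, smul_eq_mul]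

lemma mul_conj_cancel_right (x y : O.C) : (y * x) * O.conj x = O.n x • y := by
  refine O.ext_pol fun z => ?_
  rw [pol_mul_right, conj_conj, pol_mul_mul_right, map_smul, LinearMap.smul_apply, smul_eq_mul]

lemma conj_mul_cancel_right (x y : O.C) : (y * O.conj x) * x = O.n x • y := by
  simpa [conj_conj, n_conj] using O.mul_conj_cancel_right (O.conj x) y

lemma mul_conj_self (x : O.C) : x * O.conj x = O.n x • (1 : O.C) := by
  simpa using O.mul_conj_cancel_right x 1

lemma conj_mul_self (x : O.C) : O.conj x * x = O.n x • (1 : O.C) := by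
  simpa using O.conj_mul_cancel_right x 1

lemma pol_mul_one_comm (x y : O.C) : O.pol (x * y) 1 = O.pol (y * x) 1 := by
  rw [pol_mul_left, O.pol_mul_right y x, mul_one, one_mul]

lemma pol_mul_assoc_one (x y z : O.C) : O.pol (x * y * z) 1 = O.pol (x * (y * z)) 1 := by
  rw [pol_mul_right, pol_mul_right, O.pol_mul_right x, one_mul, one_mul, conj_mul]

/-- The trilinear form `n(a, conj (b c))` is cyclically invariant. -/
lemma pol_conj_mul_cyclic (a b c : O.C) :
    O.pol a (O.conj (b * c)) = O.pol c (O.conj (a * b)) := by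
  rw [conj_mul, ← pol_mul_right, ← pol_conj_left, pol_comm]

/-- A form of the middle Moufang identity. -/
lemma mul_mul_mul_eq (a b c : O.C) :
    (a * b) * (c * a) = O.pol a (O.conj (b * c)) • a - O.n a • O.conj (b * c) := by
  refine O.ext_pol fun z => ?_
  have h := O.pol_mul_mul_add c a (O.conj b * O.conj a) z
  rw [conj_mul_cancel_right, map_smul, smul_eq_mul, ← conj_mul] at h
  rw [map_sub, LinearMap.sub_apply, map_smul, LinearMap.smul_apply, map_smul,
    LinearMap.smul_apply, smul_eq_mul, smul_eq_mul, pol_conj_mul_cyclic,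
    O.conj_mul b c, O.pol_comm (O.conj c * O.conj b) z]
  linear_combination h + O.pol_mul_left (a * b) (c * a) z
    - O.n a * O.pol_mul_left c z (O.conj b)

lemma eq_smul_one_of_conj_eq (h2 : (2 : F) ≠ 0) {x : O.C} (h : x = O.conj x) :
    x = ((2 : F)⁻¹ * O.pol x 1) • (1 : O.C) := by
  rw [conj_eq, eq_sub_iff_add_eq, ← two_smul F] at h
  rw [mul_smul, ← h, smul_smul, inv_mul_cancel₀ h2, one_smul]

end OctonionAlgebra

namespace ReducedAlbert

variable {F : Type u} [Field F] (A : ReducedAlbert.{u, v} F)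

lemma trace_eq (x : A.M) : A.trace x = (2 : F)⁻¹ * ∑ i, A.O.pol (x i i) 1 := rfl

lemma trace_add (x y : A.M) : A.trace (x + y) = A.trace x + A.trace y := by
  simp only [trace_eq, Matrix.add_apply, map_add, LinearMap.add_apply, Finset.sum_add_distrib]
  ring

lemma trace_smul (s : F) (x : A.M) : A.trace (s • x) = s * A.trace x := by
  simp only [trace_eq, Matrix.smul_apply, map_smul, LinearMap.smul_apply, smul_eq_mul,
    ← Finset.mul_sum]
  ring

lemma trace_mul_comm (x y : A.M) : A.trace (x * y) = A.trace (y * x) := by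
  simp only [trace_eq, Matrix.mul_apply, map_sum, LinearMap.sum_apply]
  rw [Finset.sum_comm]
  simp only [A.O.pol_mul_one_comm (x _ _)]

lemma trace_mul_assoc (x y z : A.M) : A.trace (x * y * z) = A.trace (x * (y * z)) := by
  simp only [trace_eq, Matrix.mul_apply, Finset.sum_mul, Finset.mul_sum, map_sum,
    LinearMap.sum_apply, A.O.pol_mul_assoc_one]
  exact Finset.sum_congr rfl fun i _ => Finset.sum_comm

lemma tb_eq (h2 : (2 : F) ≠ 0) (x y : A.M) : A.tb x y = A.trace (x * y) := by
  rw [tb, jmul, trace_smul, trace_add, A.trace_mul_comm y x]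
  field_simp
  ring

lemma jmul_self (h2 : (2 : F) ≠ 0) (x : A.M) : A.jmul x x = x * x := by
  rw [jmul, ← two_smul F, smul_smul, inv_mul_cancel₀ h2, one_smul]

/-- The trace form as a bilinear form on the whole matrix space. -/
def tbL (h2 : (2 : F) ≠ 0) : LinearMap.BilinForm F A.M :=
  LinearMap.mk₂ F A.tb
    (fun x y z => by simp only [A.tb_eq h2, add_mul, trace_add])
    (fun s x y => by simp only [A.tb_eq h2, smul_mul_assoc, trace_smul, smul_eq_mul])
    (fun x y z => by simp only [A.tb_eq h2, mul_add, trace_add])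
    (fun s x y => by simp only [A.tb_eq h2, mul_smul_comm, trace_smul, smul_eq_mul])

lemma tb_eq_tbL (h2 : (2 : F) ≠ 0) (x y : A.M) : A.tb x y = A.tbL h2 x y := rfl

lemma tb_comm (h2 : (2 : F) ≠ 0) (x y : A.M) : A.tb x y = A.tb y x := by
  rw [A.tb_eq h2, A.tb_eq h2, trace_mul_comm]

lemma cross_eq (h2 : (2 : F) ≠ 0) (x y : A.M) :
    A.cross x y = x * y + y * x - A.trace x • y - A.trace y • x
      + (A.trace x * A.trace y - A.tb x y) • (1 : A.M) := by
  have h : (2 : F)⁻¹ * ((A.trace x + A.trace y) ^ 2 - A.tb (x + y) (x + y))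
      = (2 : F)⁻¹ * (A.trace x ^ 2 - A.tb x x) + (2 : F)⁻¹ * (A.trace y ^ 2 - A.tb y y)
        + (A.trace x * A.trace y - A.tb x y) := by
    have := A.tb_comm h2 x y
    simp only [A.tb_eq_tbL h2, map_add, LinearMap.add_apply] at this ⊢
    rw [← this]
    field_simp
    ring
  simp only [cross, sharp, A.jmul_self h2, trace_add, h, add_mul, mul_add]
  module

/-- The Freudenthal cross product as a bilinear map on the whole matrix space. -/
def crossL (h2 : (2 : F) ≠ 0) : A.M →ₗ[F] A.M →ₗ[F] A.M :=
  LinearMap.mk₂ F A.cross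
    (fun x y z => by
      simp only [A.cross_eq h2, A.tb_eq_tbL h2, map_add, LinearMap.add_apply, trace_add,
        add_mul, mul_add]
      module)
    (fun s x y => by
      simp only [A.cross_eq h2, A.tb_eq_tbL h2, map_smul, LinearMap.smul_apply, trace_smul,
        smul_mul_assoc, mul_smul_comm, smul_eq_mul]
      module)
    (fun x y z => by
      simp only [A.cross_eq h2, A.tb_eq_tbL h2, map_add, trace_add, add_mul, mul_add]
      module)
    (fun s x y => by
      simp only [A.cross_eq h2, A.tb_eq_tbL h2, map_smul, trace_smul,
        smul_mul_assoc, mul_smul_comm, smul_eq_mul]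
      module)

lemma cross_eq_crossL (h2 : (2 : F) ≠ 0) (x y : A.M) : A.cross x y = A.crossL h2 x y := rfl

lemma cross_comm (x y : A.M) : A.cross x y = A.cross y x := by
  rw [cross, cross, add_comm x y]
  abel

lemma sharp_add (x y : A.M) : A.sharp (x + y) = A.sharp x + A.cross x y + A.sharp y := by
  rw [cross]; abel

lemma sharp_smul (h2 : (2 : F) ≠ 0) (s : F) (x : A.M) :
    A.sharp (s • x) = s ^ 2 • A.sharp x := by
  simp only [sharp, A.jmul_self h2, A.tb_eq h2, trace_smul, smul_mul_assoc, mul_smul_comm]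
  module

lemma cross_self (h2 : (2 : F) ≠ 0) (x : A.M) : A.cross x x = (2 : F) • A.sharp x := by
  rw [cross, ← two_smul F x, A.sharp_smul h2]
  module

lemma tb_one (h2 : (2 : F) ≠ 0) (x : A.M) : A.tb 1 x = A.trace x := by
  rw [A.tb_eq h2, one_mul]

lemma tb_cross (h2 : (2 : F) ≠ 0) (x y z : A.M) :
    A.tb (A.cross x y) z = A.tb x (A.cross y z) := by
  have e1 : A.tb (A.cross x y) z = A.trace (x * y * z) + A.trace (y * x * z)
      - A.trace x * A.tb y z - A.trace y * A.tb x z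
      + (A.trace x * A.trace y - A.tb x y) * A.trace z := by
    rw [A.cross_eq h2, ← A.tb_one h2 z]
    simp only [A.tb_eq_tbL h2, map_add, map_sub, map_smul, LinearMap.add_apply,
      LinearMap.sub_apply, LinearMap.smul_apply, smul_eq_mul]
    simp only [← A.tb_eq_tbL h2]
    rw [A.tb_eq h2 (x * y), A.tb_eq h2 (y * x)]
  have e2 : A.tb x (A.cross y z) = A.trace (x * (y * z)) + A.trace (x * (z * y))
      - A.trace y * A.tb x z - A.trace z * A.tb x y
      + (A.trace y * A.trace z - A.tb y z) * A.trace x := by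
    rw [A.cross_eq h2, ← A.tb_one h2 x, A.tb_comm h2 1 x]
    simp only [A.tb_eq_tbL h2, map_add, map_sub, map_smul, smul_eq_mul]
    simp only [← A.tb_eq_tbL h2]
    rw [A.tb_eq h2 x (y * z), A.tb_eq h2 x (z * y)]
  have e3 : A.trace (y * x * z) = A.trace (x * (z * y)) := by
    rw [trace_mul_assoc, trace_mul_comm, trace_mul_assoc]
  rw [e1, e2, e3, trace_mul_assoc]
  ring

/-- The ratio `γⱼ / γᵢ`. -/
def ratio (i j : Fin 3) : F := (A.γ i : F)⁻¹ * (A.γ j : F)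

lemma elt_mem_J (ε : Fin 3 → F) (a b c : A.O.C) : A.elt ε a b c ∈ A.J := by
  have h (i j : Fin 3) : (A.γ i : F)⁻¹ * (A.γ j : F) * ((A.γ j : F)⁻¹ * (A.γ i : F)) = 1 := by
    field_simp
  intro i j
  fin_cases i <;> fin_cases j <;>
    simp [elt, OctonionAlgebra.conj_one, OctonionAlgebra.conj_conj, smul_smul, h]

lemma exists_eq_elt (h2 : (2 : F) ≠ 0) {x : A.M} (hx : x ∈ A.J) :
    ∃ ε a b c, x = A.elt ε a b c := by
  refine ⟨fun i => (2 : F)⁻¹ * A.O.pol (x i i) 1, x 1 2, x 2 0, x 0 1, ?_⟩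
  have hd (i : Fin 3) : x i i = ((2 : F)⁻¹ * A.O.pol (x i i) 1) • (1 : A.O.C) := by
    refine A.O.eq_smul_one_of_conj_eq h2 ?_
    simpa using hx i i
  ext i j
  fin_cases i <;> fin_cases j
  · exact hd 0
  · rfl
  · exact hx 0 2
  · exact hx 1 0
  · exact hd 1
  · rfl
  · rfl
  · exact hx 2 1
  · exact hd 2

lemma ratio_eq (i j : Fin 3) : A.ratio i j = (A.γ i : F)⁻¹ * (A.γ j : F) := rfl

lemma trace_elt (h2 : (2 : F) ≠ 0) (ε : Fin 3 → F) (a b c : A.O.C) :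
    A.trace (A.elt ε a b c) = ε 0 + ε 1 + ε 2 := by
  simp only [trace_eq, Fin.sum_univ_three]
  simp only [elt, Matrix.of_apply, Matrix.cons_val, map_smul, LinearMap.smul_apply, smul_eq_mul,
    A.O.pol_one_one]
  field_simp

lemma tb_elt (h2 : (2 : F) ≠ 0) (ε δ : Fin 3 → F) (a b c a' b' c' : A.O.C) :
    A.tb (A.elt ε a b c) (A.elt δ a' b' c') = ε 0 * δ 0 + ε 1 * δ 1 + ε 2 * δ 2
      + A.ratio 2 1 * A.O.pol a a' + A.ratio 0 2 * A.O.pol b b' + A.ratio 1 0 * A.O.pol c c' := by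
  have h (x y : A.O.C) : A.O.pol (x * A.O.conj y) 1 = A.O.pol x y := by
    rw [A.O.pol_mul_right, A.O.conj_conj, one_mul]
  have h' (x y : A.O.C) : A.O.pol (A.O.conj x * y) 1 = A.O.pol x y := by
    rw [A.O.pol_mul_left, A.O.conj_conj, mul_one, A.O.pol_comm]
  rw [A.tb_eq h2]
  simp only [trace_eq, Fin.sum_univ_three, Matrix.mul_apply]
  simp only [elt, Matrix.of_apply, Matrix.cons_val, map_smul, LinearMap.smul_apply, smul_eq_mul,
    A.O.pol_one_one, map_add, LinearMap.add_apply, smul_mul_assoc, mul_smul_comm, one_mul, h, h',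
    ratio_eq]
  field_simp
  ring

lemma sharp_elt (h2 : (2 : F) ≠ 0) (ε : Fin 3 → F) (a b c : A.O.C) :
    A.sharp (A.elt ε a b c) = A.elt
      ![ε 1 * ε 2 - A.ratio 2 1 * A.O.n a, ε 0 * ε 2 - A.ratio 0 2 * A.O.n b,
        ε 0 * ε 1 - A.ratio 1 0 * A.O.n c]
      (A.ratio 1 2 • A.O.conj (b * c) - ε 0 • a) (A.ratio 2 0 • A.O.conj (c * a) - ε 1 • b)
      (A.ratio 0 1 • A.O.conj (a * b) - ε 2 • c) := by
  rw [sharp, A.jmul_self h2, A.trace_elt h2, A.tb_elt h2]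
  simp only [A.O.pol_self]
  ext i j
  fin_cases i <;> fin_cases j <;>
    simp only [Fin.zero_eta, Fin.mk_one, Fin.reduceFinMk, Matrix.add_apply, Matrix.sub_apply,
      Matrix.smul_apply, Matrix.mul_apply, Fin.sum_univ_three, elt, Matrix.of_apply,
      Matrix.cons_val, Matrix.one_apply, Fin.reduceEq, if_true, if_false, smul_mul_assoc,
      mul_smul_comm, one_mul, mul_one, A.O.conj_mul_self, A.O.mul_conj_self, map_sub, map_smul,
      A.O.conj_conj, A.O.conj_mul, ratio_eq] <;>
    match_scalars <;> field_simp <;> ring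

lemma sharp_mem_J (h2 : (2 : F) ≠ 0) {x : A.M} (hx : x ∈ A.J) : A.sharp x ∈ A.J := by
  obtain ⟨ε, a, b, c, rfl⟩ := A.exists_eq_elt h2 hx
  rw [A.sharp_elt h2]
  exact A.elt_mem_J _ _ _ _

lemma cross_mem_J (h2 : (2 : F) ≠ 0) {x y : A.M} (hx : x ∈ A.J) (hy : y ∈ A.J) :
    A.cross x y ∈ A.J :=
  A.J.sub_mem (A.J.sub_mem (A.sharp_mem_J h2 (A.J.add_mem hx hy)) (A.sharp_mem_J h2 hx))
    (A.sharp_mem_J h2 hy)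

/-- The trace form is nondegenerate on `J`. -/
lemma eq_zero_of_tb_eq_zero (h2 : (2 : F) ≠ 0) {x : A.M} (hx : x ∈ A.J)
    (h : ∀ z ∈ A.J, A.tb x z = 0) : x = 0 := by
  obtain ⟨ε, a, b, c, rfl⟩ := A.exists_eq_elt h2 hx
  have h' (δ : Fin 3 → F) (a' b' c' : A.O.C) := h _ (A.elt_mem_J δ a' b' c')
  simp only [A.tb_elt h2] at h'
  have h0 : ε 0 = 0 := by simpa using h' ![1, 0, 0] 0 0 0
  have h1 : ε 1 = 0 := by simpa using h' ![0, 1, 0] 0 0 0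
  have h2 : ε 2 = 0 := by simpa using h' ![0, 0, 1] 0 0 0
  have ha : a = 0 := A.O.ext_pol fun z => by simpa [ratio_eq] using h' 0 z 0 0
  have hb : b = 0 := A.O.ext_pol fun z => by simpa [ratio_eq] using h' 0 0 z 0
  have hc : c = 0 := A.O.ext_pol fun z => by simpa [ratio_eq] using h' 0 0 0 z
  ext i j
  fin_cases i <;> fin_cases j <;> simp [elt, h0, h1, h2, ha, hb, hc]

lemma smul_elt (s : F) (ε : Fin 3 → F) (a b c : A.O.C) :
    s • A.elt ε a b c = A.elt (s • ε) (s • a) (s • b) (s • c) := by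
  ext i j
  fin_cases i <;> fin_cases j <;> simp [elt, smul_smul, mul_comm]

lemma sharp_sharp_off_diag (a b c : A.O.C) {k₁ k₂ k₃ l₁ l₂ l₃ : F} (e₀ e₁ e₂ : F)
    (h₁ : k₂ * k₃ = l₁) (h₂ : k₁ * k₃ = l₂) (h₃ : k₁ * k₂ = l₃) (h : k₁ * l₁ = 1) :
    k₁ • A.O.conj ((k₂ • A.O.conj (c * a) - e₁ • b) * (k₃ • A.O.conj (a * b) - e₂ • c))
      - (e₁ * e₂ - l₁ * A.O.n a) • (k₁ • A.O.conj (b * c) - e₀ • a)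
    = (A.O.pol a (A.O.conj (b * c)) + e₀ * e₁ * e₂ - e₀ * l₁ * A.O.n a - e₁ * l₂ * A.O.n b
      - e₂ * l₃ * A.O.n c) • a := by
  subst h₁ h₂ h₃
  rw [A.O.conj_mul]
  simp only [map_sub, map_smul, A.O.conj_conj, sub_mul, mul_sub, smul_mul_assoc, mul_smul_comm,
    A.O.mul_mul_mul_eq, A.O.mul_conj_cancel_right, A.O.conj_mul_cancel_left]
  rw [A.O.conj_mul b c]
  match_scalars
  · linear_combination A.O.pol a (A.O.conj c * A.O.conj b) * h
  · ring

/-- The adjoint identity. -/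
lemma sharp_sharp (h2 : (2 : F) ≠ 0) (h3 : (3 : F) ≠ 0) {x : A.M} (hx : x ∈ A.J) :
    A.sharp (A.sharp x) = ((3 : F)⁻¹ * A.tb (A.sharp x) x) • x := by
  obtain ⟨ε, a, b, c, rfl⟩ := A.exists_eq_elt h2 hx
  have hN : (3 : F)⁻¹ * A.tb (A.sharp (A.elt ε a b c)) (A.elt ε a b c)
      = A.O.pol a (A.O.conj (b * c)) + ε 0 * ε 1 * ε 2 - ε 0 * A.ratio 2 1 * A.O.n a
        - ε 1 * A.ratio 0 2 * A.O.n b - ε 2 * A.ratio 1 0 * A.O.n c := by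
    rw [A.sharp_elt h2, A.tb_elt h2]
    simp only [Matrix.cons_val, map_sub, map_smul, LinearMap.sub_apply, LinearMap.smul_apply,
      smul_eq_mul, A.O.pol_self]
    rw [A.O.pol_comm _ a, A.O.pol_comm _ b, A.O.pol_comm _ c, A.O.pol_conj_mul_cyclic b c a,
      ← A.O.pol_conj_mul_cyclic a b c]
    simp only [ratio_eq]
    field_simp
    ring
  rw [hN, A.sharp_elt h2, A.sharp_elt h2, smul_elt]
  have hb := A.O.pol_conj_mul_cyclic b c a
  have hc := A.O.pol_conj_mul_cyclic a b c
  congr 1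
  · ext i
    fin_cases i <;>
      simp only [Fin.zero_eta, Fin.mk_one, Fin.reduceFinMk, Matrix.cons_val, Pi.smul_apply,
        smul_eq_mul, A.O.n_sub, A.O.n_smul, A.O.n_conj, A.O.n_mul, map_smul,
        LinearMap.smul_apply]
    · rw [A.O.pol_comm _ a]
      simp only [ratio_eq]
      field_simp
      ring
    · rw [A.O.pol_comm _ b, hb]
      simp only [ratio_eq]
      field_simp
      ring
    · rw [A.O.pol_comm _ c, ← hc]
      simp only [ratio_eq]
      field_simp
      ring
  · simp only [Matrix.cons_val]
    rw [A.sharp_sharp_off_diag a b c (l₁ := A.ratio 2 1) (l₂ := A.ratio 0 2) (l₃ := A.ratio 1 0)]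
    all_goals simp only [ratio_eq]; field_simp
  · simp only [Matrix.cons_val]
    rw [mul_comm (ε 0) (ε 2),
      A.sharp_sharp_off_diag b c a (l₁ := A.ratio 0 2) (l₂ := A.ratio 1 0) (l₃ := A.ratio 2 1),
      hb]
    · congr 1
      ring
    all_goals simp only [ratio_eq]; field_simp
  · simp only [Matrix.cons_val]
    rw [A.sharp_sharp_off_diag c a b (l₁ := A.ratio 1 0) (l₂ := A.ratio 2 1) (l₃ := A.ratio 0 2),
      hc]
    · congr 1
      ring
    all_goals simp only [ratio_eq]; field_simp

/-- The linearised adjoint identity `x^# × (x × y) = T(x^#, y) x + N(x) y`. -/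
lemma cross_sharp_cross (h2 : (2 : F) ≠ 0) (h3 : (3 : F) ≠ 0) {x y : A.M} (hx : x ∈ A.J)
    (hy : y ∈ A.J) :
    A.cross (A.sharp x) (A.cross x y)
      = A.tb (A.sharp x) y • x + ((3 : F)⁻¹ * A.tb (A.sharp x) x) • y := by
  have key (s : F) : s • (A.cross (A.sharp x) (A.cross x y)
        - A.tb (A.sharp x) y • x - ((3 : F)⁻¹ * A.tb (A.sharp x) x) • y)
      + s ^ 2 • (A.sharp (A.cross x y) + A.cross (A.sharp x) (A.sharp y)
        - A.tb (A.sharp y) x • x - A.tb (A.sharp x) y • y)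
      + s ^ 3 • (A.cross (A.cross x y) (A.sharp y)
        - A.tb (A.sharp y) x • y - ((3 : F)⁻¹ * A.tb (A.sharp y) y) • x) = 0 := by
    have hxx := A.sharp_sharp h2 h3 hx
    have hyy := A.sharp_sharp h2 h3 hy
    have h := A.sharp_sharp h2 h3 (A.J.add_mem hx (A.J.smul_mem s hy))
    have e1 : A.tb (A.cross x y) x = 2 * A.tb (A.sharp x) y := by
      rw [A.tb_comm h2, ← A.tb_cross h2, A.cross_self h2, A.tb_eq_tbL h2, map_smul,
        LinearMap.smul_apply, smul_eq_mul, A.tb_eq_tbL h2]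
    have e2 : A.tb (A.cross x y) y = 2 * A.tb (A.sharp y) x := by
      rw [A.tb_cross h2, A.cross_self h2, A.tb_comm h2, A.tb_eq_tbL h2, map_smul,
        LinearMap.smul_apply, smul_eq_mul, A.tb_eq_tbL h2]
    have e0 : A.sharp (x + s • y) = A.sharp x + s • A.cross x y + s ^ 2 • A.sharp y := by
      rw [sharp_add, A.sharp_smul h2, A.cross_eq_crossL h2, map_smul, A.cross_eq_crossL h2]
    have eT : (3 : F)⁻¹ * A.tb (A.sharp (x + s • y)) (x + s • y)
        = (3 : F)⁻¹ * A.tb (A.sharp x) x + s * A.tb (A.sharp x) y + s ^ 2 * A.tb (A.sharp y) x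
          + s ^ 3 * ((3 : F)⁻¹ * A.tb (A.sharp y) y) := by
      rw [e0]
      simp only [A.tb_eq_tbL h2, map_add, map_smul, LinearMap.add_apply, LinearMap.smul_apply,
        smul_eq_mul] at e1 e2 ⊢
      rw [e1, e2]
      field_simp
      ring
    rw [eT, e0, sharp_add, sharp_add, A.sharp_smul h2, A.sharp_smul h2, hxx, hyy] at h
    simp only [A.cross_eq_crossL h2, map_add, map_smul, LinearMap.add_apply,
      LinearMap.smul_apply] at h ⊢
    rw [← sub_eq_zero] at h
    rw [← h]
    module
  have k1 := key 1
  have k2 := key (-1)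
  have k3 := key 2
  have k4 := key (-2)
  rw [← sub_eq_zero, ← sub_sub]
  generalize A.cross (A.sharp x) (A.cross x y) - A.tb (A.sharp x) y • x
    - ((3 : F)⁻¹ * A.tb (A.sharp x) x) • y = P at *
  have h12 : (2 * 2 * 3 : F) • P = 0 := by
    linear_combination (norm := module) (8 : F) • k1 - (8 : F) • k2 - k3 + k4
  exact (smul_eq_zero.mp h12).resolve_left (mul_ne_zero (mul_ne_zero h2 h2) h3)

lemma tb_cross_cross (h2 : (2 : F) ≠ 0) (x y w z : A.M) :
    A.tb (A.cross x (A.cross y w)) z = A.tb w (A.cross y (A.cross x z)) := by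
  rw [A.cross_comm x, A.tb_cross h2, A.cross_comm y w, A.tb_cross h2]

/-- The identity `x × (x^# × y) = T(x, y) x^# + N(x) y`. -/
lemma cross_cross_sharp (h2 : (2 : F) ≠ 0) (h3 : (3 : F) ≠ 0) {x y : A.M} (hx : x ∈ A.J)
    (hy : y ∈ A.J) :
    A.cross x (A.cross (A.sharp x) y)
      = A.tb x y • A.sharp x + ((3 : F)⁻¹ * A.tb (A.sharp x) x) • y := by
  have hs := A.sharp_mem_J h2 hx
  rw [← sub_eq_zero]
  refine A.eq_zero_of_tb_eq_zero h2 (A.J.sub_mem (A.cross_mem_J h2 hx (A.cross_mem_J h2 hs hy))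
    (A.J.add_mem (A.J.smul_mem _ hs) (A.J.smul_mem _ hy))) fun z hz => ?_
  have h := A.tb_cross_cross h2 x (A.sharp x) y z
  rw [A.cross_sharp_cross h2 h3 hx hz] at h
  have hxy := A.tb_comm h2 x y
  simp only [A.tb_eq_tbL h2, map_add, map_sub, map_smul, LinearMap.add_apply,
    LinearMap.sub_apply, LinearMap.smul_apply, smul_eq_mul] at h hxy ⊢
  rw [h, hxy]
  ring

lemma brok_eq_zero_iff (h2 : (2 : F) ≠ 0) (x y z : A.M) :
    A.brok x y z = 0 ↔
      A.cross y (A.cross x z) = A.tb z y • x + ((3 : F)⁻¹ * A.tb x y) • z := by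
  rw [brok, smul_eq_zero, sub_sub, sub_eq_zero]
  exact or_iff_right (inv_ne_zero h2)

/-- If `⟨x,y⟩` vanishes on `J`, then so does `⟨y,x⟩`. -/
lemma brok_swap_eq_zero (h2 : (2 : F) ≠ 0) {x y : A.M} (hx : x ∈ A.J) (hy : y ∈ A.J)
    (h : ∀ z ∈ A.J, A.brok x y z = 0) {w : A.M} (hw : w ∈ A.J) : A.brok y x w = 0 := by
  rw [A.brok_eq_zero_iff h2, ← sub_eq_zero]
  refine A.eq_zero_of_tb_eq_zero h2 (A.J.sub_mem (A.cross_mem_J h2 hx (A.cross_mem_J h2 hy hw))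
    (A.J.add_mem (A.J.smul_mem _ hy) (A.J.smul_mem _ hw))) fun z hz => ?_
  have h' := A.tb_cross_cross h2 x y w z
  rw [(A.brok_eq_zero_iff h2 x y z).mp (h z hz)] at h'
  have hxy := A.tb_comm h2 x y
  have hyz := A.tb_comm h2 y z
  simp only [A.tb_eq_tbL h2, map_add, map_sub, map_smul, LinearMap.add_apply,
    LinearMap.sub_apply, LinearMap.smul_apply, smul_eq_mul] at h' hxy hyz ⊢
  rw [h', hxy, hyz]
  ring

/-- If `(j')^# = α·j` and `j^# = β·j'` with `α` or `β` nonzero, then `⟨j,j'⟩ = 0`. -/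
lemma brok_eq_zero_of_conditions (h2 : (2 : F) ≠ 0) (h3 : (3 : F) ≠ 0) {α β : F} {j j' : A.M}
    (hj : j ∈ A.J) (hj' : j' ∈ A.J) (hαβ : α ≠ 0 ∨ β ≠ 0)
    (hs' : A.sharp j' = α • j) (hs : A.sharp j = β • j') {z : A.M} (hz : z ∈ A.J) :
    A.brok j j' z = 0 := by
  rw [A.brok_eq_zero_iff h2]
  rcases hαβ with h0 | h0
  · have h := A.cross_cross_sharp h2 h3 hj' hz
    rw [hs'] at h
    simp only [A.cross_eq_crossL h2, A.tb_eq_tbL h2, map_smul, LinearMap.smul_apply] at h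
    simp only [← A.cross_eq_crossL h2, ← A.tb_eq_tbL h2] at h
    apply smul_right_injective _ h0
    simp only
    rw [h, A.tb_comm h2 j' z]
    module
  · have h := A.cross_sharp_cross h2 h3 hj hz
    rw [hs] at h
    simp only [A.cross_eq_crossL h2, A.tb_eq_tbL h2, map_smul, LinearMap.smul_apply] at h
    simp only [← A.cross_eq_crossL h2, ← A.tb_eq_tbL h2] at h
    apply smul_right_injective _ h0
    simp only
    rw [h, A.tb_comm h2 j' z, A.tb_comm h2 j' j]
    module

/-- The explicit form of `U_e(x)` in `B(J, F×F)`. -/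
lemma brace_eq (h2 : (2 : F) ≠ 0) (α β a b : F) (j j' k k' : A.M) :
    A.brace 1 ((α, j, j', β) : A.Bam) ((a, k, k', b) : A.Bam) ((α, j, j', β) : A.Bam) =
      (2 * α ^ 2 * b + a * (A.tb j j' - α * β) + 2 * α * A.tb k j' + 2 * A.tb (A.sharp j') k',
       (2 * b) • A.sharp j' + (2 * β * a + 2 * A.tb j k') • j
        + (2 : F) • (β • A.cross j' k' - A.cross (A.sharp j) k')
        + (2 : F) • A.cross j' (A.cross j k) + (α * β - A.tb j j') • k,
       (2 * a) • A.sharp j + (2 * α * b + 2 * A.tb k j') • j'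
        + (2 : F) • (α • A.cross j k - A.cross (A.sharp j') k)
        + (2 : F) • A.cross j (A.cross j' k') + (α * β - A.tb j j') • k',
       2 * β ^ 2 * a + b * (A.tb j j' - α * β) + 2 * β * A.tb j k' + 2 * A.tb (A.sharp j) k) := by
  have e1 : A.tb (A.cross j' k') j' = 2 * A.tb (A.sharp j') k' := by
    rw [A.cross_comm, A.tb_cross h2, A.cross_self h2, A.tb_comm h2, A.tb_eq_tbL h2, map_smul,
      LinearMap.smul_apply, smul_eq_mul, A.tb_eq_tbL h2]
  have e2 : A.tb j (A.cross j k) = 2 * A.tb (A.sharp j) k := by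
    rw [← A.tb_cross h2, A.cross_self h2, A.tb_eq_tbL h2, map_smul,
      LinearMap.smul_apply, smul_eq_mul, A.tb_eq_tbL h2]
  have e3 : A.cross (A.cross j k) j' = A.cross j' (A.cross j k) := A.cross_comm _ _
  have e4 : A.cross (A.cross j' k') j = A.cross j (A.cross j' k') := A.cross_comm _ _
  have e5 : A.cross k' j' = A.cross j' k' := A.cross_comm _ _
  have e6 : A.cross k j = A.cross j k := A.cross_comm _ _
  have e7 := A.cross_self h2 j
  have e8 := A.cross_self h2 j'
  have e9 := A.tb_comm h2 k (A.sharp j)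
  simp only [brace, bmul, binv, Prod.mk_add_mk, Prod.mk_sub_mk]
  simp only [A.cross_eq_crossL h2, A.tb_eq_tbL h2, map_add, map_smul, LinearMap.add_apply,
    LinearMap.smul_apply, smul_eq_mul, one_mul, one_smul] at e1 e2 e3 e4 e5 e6 e7 e8 e9 ⊢
  simp only [e1, e2, e3, e4, e5, e6, e7, e8, e9, map_smul, LinearMap.smul_apply, smul_eq_mul]
  refine Prod.ext ?_ (Prod.ext ?_ (Prod.ext ?_ ?_)) <;> simp only
  · ring
  · module
  · module
  · ring

lemma cross_zero_left (h2 : (2 : F) ≠ 0) (x : A.M) : A.cross 0 x = 0 := by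
  rw [A.cross_eq_crossL h2, map_zero, LinearMap.zero_apply]

lemma cross_zero_right (h2 : (2 : F) ≠ 0) (x : A.M) : A.cross x 0 = 0 := by
  rw [A.cross_eq_crossL h2, map_zero]

lemma tb_zero_right (h2 : (2 : F) ≠ 0) (x : A.M) : A.tb x 0 = 0 := by
  rw [A.tb_eq_tbL h2, map_zero]

lemma tb_zero_left (h2 : (2 : F) ≠ 0) (x : A.M) : A.tb 0 x = 0 := by
  rw [A.tb_eq_tbL h2, map_zero, LinearMap.zero_apply]

lemma sharp_zero (h2 : (2 : F) ≠ 0) : A.sharp 0 = 0 := by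
  simpa using A.sharp_smul h2 0 0

/-- The conditions on `(α, j; j', β)` imply that `U_e` has image in `F·e`. -/
lemma brace_mem_of_conditions (h2 : (2 : F) ≠ 0) (h3 : (3 : F) ≠ 0) {α β : F} {j j' : A.M}
    (hj : j ∈ A.J) (hj' : j' ∈ A.J) (ht : A.tb j j' = 3 * α * β)
    (hs' : A.sharp j' = α • j) (hs : A.sharp j = β • j') (hb : ∀ z ∈ A.J, A.brok j j' z = 0)
    {x : A.Bam} (hx : x ∈ A.Bsub) :
    ∃ c : F, A.brace 1 ((α, j, j', β) : A.Bam) x ((α, j, j', β) : A.Bam)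
      = c • ((α, j, j', β) : A.Bam) := by
  obtain ⟨a, k, k', b⟩ := x
  obtain ⟨hk, hk'⟩ : k ∈ A.J ∧ k' ∈ A.J := hx
  have h4 := (A.brok_eq_zero_iff h2 j j' k).mp (hb k hk)
  have h5 := (A.brok_eq_zero_iff h2 j' j k').mp (A.brok_swap_eq_zero h2 hj hj' hb hk')
  have ht3 : (3 : F)⁻¹ * (3 * α * β) = α * β := by field_simp
  rw [ht, ht3] at h4
  rw [A.tb_comm h2 j' j, ht, ht3, A.tb_comm h2 k' j] at h5
  refine ⟨2 * (α * b + β * a + A.tb k j' + A.tb j k'), ?_⟩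
  rw [A.brace_eq h2, h4, h5, ht, hs, hs']
  simp only [A.cross_eq_crossL h2, A.tb_eq_tbL h2, map_smul, LinearMap.smul_apply, smul_eq_mul]
  have hc : A.tbL h2 j' k = A.tbL h2 k j' := A.tb_comm h2 j' k
  rw [hc]
  refine Prod.ext ?_ (Prod.ext ?_ (Prod.ext ?_ ?_)) <;>
    simp only [Prod.smul_fst, Prod.smul_snd, smul_eq_mul]
  · ring
  · module
  · module
  · ring

/-- A singular element satisfies `T(j,j') = 3αβ`, `(j')^# = α·j` and `j^# = β·j'`. -/
lemma conditions_of_isSingular (h2 : (2 : F) ≠ 0) {α β : F} {j j' : A.M}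
    (h : A.IsSingular 1 ((α, j, j', β) : A.Bam)) :
    A.tb j j' = 3 * α * β ∧ A.sharp j' = α • j ∧ A.sharp j = β • j' := by
  obtain ⟨c, hc⟩ := h.2 ((1, 0, 0, 0) : A.Bam) ⟨A.J.zero_mem, A.J.zero_mem⟩
  obtain ⟨d, hd⟩ := h.2 ((0, 0, 0, 1) : A.Bam) ⟨A.J.zero_mem, A.J.zero_mem⟩
  rw [A.brace_eq h2] at hc hd
  simp only [A.cross_zero_right h2, A.tb_zero_right h2, A.tb_zero_left h2, mul_zero, mul_one,
    smul_zero, add_zero, zero_add, zero_smul, sub_zero, one_mul, zero_mul, Prod.smul_mk,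
    Prod.mk.injEq, smul_eq_mul] at hc hd
  obtain ⟨c1, c2, c3, c4⟩ := hc
  obtain ⟨d1, d2, d3, d4⟩ := hd
  have of_two {x y : A.M} (h : (2 : F) • x = (2 : F) • y) : x = y :=
    smul_right_injective _ h2 h
  have hsj : A.sharp j = β • j' := by
    by_cases hβ : β = 0
    · subst hβ
      rw [zero_smul]
      apply of_two
      rw [c3, smul_zero]
      by_cases hc0 : c = 0
      · rw [hc0, zero_smul]
      · have hj0 : j = 0 := by
          rw [mul_zero, zero_smul] at c2
          exact (smul_eq_zero.mp c2.symm).resolve_left hc0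
        rw [← c3, hj0, A.sharp_zero h2, smul_zero]
    · apply of_two
      rw [c3, smul_smul]
      congr 1
      apply mul_right_cancel₀ hβ
      linear_combination -c4
  have hsj' : A.sharp j' = α • j := by
    by_cases hα : α = 0
    · subst hα
      rw [zero_smul]
      apply of_two
      rw [d2, smul_zero]
      by_cases hd0 : d = 0
      · rw [hd0, zero_smul]
      · have hj0 : j' = 0 := by
          rw [mul_zero, zero_smul] at d3
          exact (smul_eq_zero.mp d3.symm).resolve_left hd0
        rw [← d2, hj0, A.sharp_zero h2, smul_zero]
    · apply of_two
      rw [d2, smul_smul]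
      congr 1
      apply mul_right_cancel₀ hα
      linear_combination -d1
  refine ⟨?_, hsj', hsj⟩
  by_cases hβ : β = 0
  · subst hβ
    linear_combination d4
  · have : c = 2 * β := mul_right_cancel₀ hβ (by linear_combination -c4)
    rw [this] at c1
    linear_combination c1

/-- A singular element satisfies `⟨j,j'⟩ = 0`. -/
lemma brok_eq_zero_of_isSingular (h2 : (2 : F) ≠ 0) (h3 : (3 : F) ≠ 0) {α β : F} {j j' : A.M}
    (hj : j ∈ A.J) (hj' : j' ∈ A.J) (h : A.IsSingular 1 ((α, j, j', β) : A.Bam))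
    {z : A.M} (hz : z ∈ A.J) : A.brok j j' z = 0 := by
  obtain ⟨ht, hs', hs⟩ := A.conditions_of_isSingular h2 h
  by_cases hαβ : α ≠ 0 ∨ β ≠ 0
  · exact A.brok_eq_zero_of_conditions h2 h3 hj hj' hαβ hs' hs hz
  · push Not at hαβ
    obtain ⟨rfl, rfl⟩ := hαβ
    rw [A.brok_eq_zero_iff h2, ht]
    obtain ⟨c, hc⟩ := h.2 ((0, z, 0, 0) : A.Bam) ⟨hz, A.J.zero_mem⟩
    rw [A.brace_eq h2, hs, hs', ht] at hc
    simp only [A.cross_zero_right h2, A.cross_zero_left h2, A.tb_zero_right h2, mul_zero,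
      smul_zero, add_zero, zero_add, zero_smul, sub_zero, zero_mul, Prod.smul_mk,
      Prod.mk.injEq] at hc ⊢
    obtain ⟨-, c2, c3, -⟩ := hc
    by_cases hj0 : j' = 0
    · rw [hj0, A.cross_zero_left h2, A.tb_zero_right h2, zero_smul]
    · apply smul_right_injective _ h2
      simp only
      rw [c2, smul_smul, smul_left_injective F hj0 c3]

end ReducedAlbert

/-- A nonzero `e = (α,j;j',β) ∈ B(J,F×F)` is singular iff
(1) `T(j,j') = 3αβ`, (2) `(j')^# = α·j`, (3) `j^# = β·j'`, and (4) `⟨j,j'⟩ = 0`.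
Moreover if `α ≠ 0` or `β ≠ 0` then (1)–(3) imply (4). -/
theorem stmt9 {F : Type u} [Field F] (h2 : (2 : F) ≠ 0) (h3 : (3 : F) ≠ 0)
    (A : ReducedAlbert.{u, v} F) (α β : F) (j j' : A.M)
    (hj : j ∈ A.J) (hj' : j' ∈ A.J) (hne : ((α, j, j', β) : A.Bam) ≠ 0) :
    (A.IsSingular 1 ((α, j, j', β) : A.Bam) ↔
      (A.tb j j' = 3 * α * β ∧ A.sharp j' = α • j ∧ A.sharp j = β • j' ∧
        ∀ z ∈ A.J, A.brok j j' z = 0)) ∧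
    ((α ≠ 0 ∨ β ≠ 0) →
      (A.tb j j' = 3 * α * β ∧ A.sharp j' = α • j ∧ A.sharp j = β • j') →
      ∀ z ∈ A.J, A.brok j j' z = 0) := by
  refine ⟨⟨fun h => ?_, fun ⟨ht, hs', hs, hb⟩ => ⟨hne, fun x hx => ?_⟩⟩,
    fun hαβ ⟨_, hs', hs⟩ z hz => ?_⟩
  · obtain ⟨ht, hs', hs⟩ := A.conditions_of_isSingular h2 h
    exact ⟨ht, hs', hs, fun z hz => A.brok_eq_zero_of_isSingular h2 h3 hj hj' h hz⟩
  · exact A.brace_mem_of_conditions h2 h3 hj hj' ht hs' hs hb hx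
  · exact A.brok_eq_zero_of_conditions h2 h3 hj hj' hαβ hs' hs hz
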